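/- The factorization number F₂(ZM(m,n,r)), i.e. the number of ordered pairs (H,K) of subgroups with HK = ZM(m,n,r), equals the sum over m₂,m₃ | m, n₂,n₃ | n with gcd(m₂,m₃) = 1 and gcd(n₂,n₃) = 1 of gcd(m₂,(r^n−1)/(r^{n₂}−1)) · gcd(m₃,(r^n−1)/(r^{n₃}−1)). -/

import Mathlib

open Pointwise

/-- The relators of the Zassenhaus metacyclic group
`ZM(m,n,r) = ⟨a, b | a^m = b^n = 1, b⁻¹ab = a^r⟩`. -/
def ZMrel (m n r : ℕ) : Set (FreeGroup (Fin 2)) :=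
  {FreeGroup.of 0 ^ m, FreeGroup.of 1 ^ n,
   (FreeGroup.of 1)⁻¹ * FreeGroup.of 0 * FreeGroup.of 1 * (FreeGroup.of 0 ^ r)⁻¹}

/-- The ZM-group `ZM(m,n,r)` as a presented group. -/
abbrev ZM (m n r : ℕ) : Type := PresentedGroup (ZMrel m n r)

/-- The generator `a` of `ZM(m,n,r)`. -/
def za (m n r : ℕ) : ZM m n r := PresentedGroup.of 0

/-- The generator `b` of `ZM(m,n,r)`. -/
def zb (m n r : ℕ) : ZM m n r := PresentedGroup.of 1

/-- `G` is the split metacyclic group of order `m * n` generated by `a`, of order `m`, and `b`,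
of order `n`, with `b⁻¹ * a * b = a ^ r`; the homomorphism `π` is the projection onto `⟨b⟩`. -/
structure IsSplitMetacyclic {G : Type*} [Group G] (m n r : ℕ) (a b : G)
    (π : G →* Multiplicative (ZMod n)) : Prop where
  m_pos : 0 < m
  n_pos : 0 < n
  b_pow : b ^ n = 1
  conj : a * b = b * a ^ r
  zpow_a : ∀ i : ℤ, a ^ i = 1 ↔ (m : ℤ) ∣ i
  map_a : π a = 1
  map_b : π b = Multiplicative.ofAdd 1
  exists_form : ∀ g : G, ∃ (j : ℕ) (i : ℤ), g = b ^ j * a ^ i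

/-- The subgroup `H` meets `⟨a⟩` in `⟨a ^ d⟩`, and its image modulo `⟨a⟩` is generated by the image
of `b ^ e`. -/
def HasType {G : Type*} [Group G] (a b : G) (d e : ℕ) (H : Subgroup G) : Prop :=
  (∀ i : ℤ, a ^ i ∈ H ↔ (d : ℤ) ∣ i) ∧ ∀ j : ℤ, (∃ i : ℤ, b ^ j * a ^ i ∈ H) ↔ (e : ℤ) ∣ j

theorem Subgroup.exists_zpow_mem_iff_dvd {G : Type*} [Group G] (K : Subgroup G) (x : G) :
    ∃ d : ℕ, ∀ i : ℤ, x ^ i ∈ K ↔ (d : ℤ) ∣ i := by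
  let S : AddSubgroup ℤ :=
    { carrier := {i | x ^ i ∈ K}
      add_mem' := fun {i j} hi hj => by
        simpa [zpow_add] using K.mul_mem hi hj
      zero_mem' := by simp
      neg_mem' := fun {i} hi => by simpa using hi }
  obtain ⟨d, hd⟩ := Int.subgroup_cyclic S
  refine ⟨d.natAbs, fun i => ?_⟩
  have : i ∈ S ↔ d ∣ i := by
    rw [hd, AddSubgroup.mem_closure_singleton]
    constructor
    · rintro ⟨k, rfl⟩
      exact ⟨k, by simp [mul_comm]⟩
    · rintro ⟨k, rfl⟩
      exact ⟨k, by simp [mul_comm]⟩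
  rw [Int.natAbs_dvd]
  exact this

theorem zpow_mul_pow_of_mul_eq {G : Type*} [Group G] {a b : G} {r : ℕ} (h : a * b = b * a ^ r)
    (j : ℕ) (i : ℤ) :
    a ^ i * b ^ j = b ^ j * a ^ (i * r ^ j) := by
  induction j generalizing i with
  | zero => simp
  | succ j ih =>
    have hb : a ^ i * b = b * a ^ (i * r) := by
      have h1 : SemiconjBy b (a ^ r) a := h.symm
      have h2 := h1.zpow_right i
      rw [SemiconjBy, ← zpow_natCast, ← zpow_mul] at h2
      rw [← h2, mul_comm i]
    rw [pow_succ', ← mul_assoc, hb, mul_assoc, ih, ← mul_assoc, pow_succ', mul_assoc i]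

namespace IsSplitMetacyclic

variable {G : Type*} [Group G] {m n r : ℕ} {a b : G} {π : G →* Multiplicative (ZMod n)}

theorem map_form (h : IsSplitMetacyclic m n r a b π) (j i : ℤ) :
    π (b ^ j * a ^ i) = Multiplicative.ofAdd (j : ZMod n) := by
  rw [map_mul, map_zpow, map_zpow, h.map_a, h.map_b, one_zpow, mul_one, ← ofAdd_zsmul]
  simp

theorem zpow_b_eq (h : IsSplitMetacyclic m n r a b π) {j k : ℤ} (hjk : (j : ZMod n) = k) :
    b ^ j = b ^ k := by
  obtain ⟨c, hc⟩ := (ZMod.intCast_eq_intCast_iff_dvd_sub _ _ _).1 hjk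
  obtain rfl : k = j + n * c := by linarith
  rw [zpow_add, zpow_mul, zpow_natCast, h.b_pow, one_zpow, mul_one]

theorem exists_zpow_of_map_eq_one (h : IsSplitMetacyclic m n r a b π) {g : G} (hg : π g = 1) :
    ∃ i : ℤ, g = a ^ i := by
  obtain ⟨j, i, rfl⟩ := h.exists_form g
  have h0 : ((j : ℤ) : ZMod n) = (0 : ℤ) := by
    have := h.map_form j i
    rw [zpow_natCast, hg] at this
    rw [Int.cast_zero]
    exact (Multiplicative.ofAdd.injective this).symm
  refine ⟨i, ?_⟩
  rw [← zpow_natCast b j, h.zpow_b_eq h0, zpow_zero, one_mul]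

theorem zpow_a_mul_pow_b (h : IsSplitMetacyclic m n r a b π) (i : ℤ) (j : ℕ) :
    a ^ i * b ^ j = b ^ j * a ^ (i * r ^ j) :=
  zpow_mul_pow_of_mul_eq h.conj j i

theorem normal_zpowers (h : IsSplitMetacyclic m n r a b π) (d : ℕ) :
    (Subgroup.zpowers (a ^ d)).Normal := by
  refine ⟨fun x hx g => ?_⟩
  obtain ⟨k, rfl⟩ := Subgroup.mem_zpowers_iff.1 hx
  obtain ⟨j, i, rfl⟩ := h.exists_form g
  have hinv : (b ^ j)⁻¹ = b ^ ((n - 1) * j) := by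
    rw [inv_eq_iff_mul_eq_one, ← pow_add]
    have : j + (n - 1) * j = n * j := by
      obtain ⟨c, hc⟩ := Nat.exists_eq_succ_of_ne_zero h.n_pos.ne'
      subst hc; simp; ring
    rw [this, pow_mul, h.b_pow, one_pow]
  refine Subgroup.mem_zpowers_iff.2 ⟨k * r ^ ((n - 1) * j), ?_⟩
  have e : b ^ j * a ^ i * (a ^ d) ^ k * (b ^ j * a ^ i)⁻¹ = b ^ j * ((a ^ d) ^ k * (b ^ j)⁻¹) := by
    have : a ^ i * (a ^ d) ^ k = (a ^ d) ^ k * a ^ i := by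
      rw [← zpow_natCast a d, ← zpow_mul, ← zpow_add, ← zpow_add, add_comm]
    rw [mul_assoc (b ^ j), this]
    group
  rw [e, hinv, ← zpow_natCast a d]
  simp only [← zpow_mul]
  rw [h.zpow_a_mul_pow_b, ← hinv, mul_inv_cancel_left, mul_assoc]

theorem pow_b_mul (h : IsSplitMetacyclic m n r a b π) (e : ℕ) (s : ℤ) (k : ℕ) :
    (b ^ e * a ^ s) ^ k = b ^ (e * k) * a ^ (s * ∑ i ∈ Finset.range k, ((r : ℤ) ^ e) ^ i) := by
  induction k with
  | zero => simp
  | succ k ih =>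
    rw [pow_succ, ih, ← mul_assoc, mul_assoc (b ^ (e * k)), h.zpow_a_mul_pow_b, ← mul_assoc,
      ← pow_add, mul_assoc, ← zpow_add, geom_sum_succ]
    congr 2
    ring

theorem mem_zpowers_iff (h : IsSplitMetacyclic m n r a b π) {d : ℕ} (hd : d ∣ m) (i : ℤ) :
    a ^ i ∈ Subgroup.zpowers (a ^ d) ↔ (d : ℤ) ∣ i := by
  rw [Subgroup.mem_zpowers_iff]
  constructor
  · rintro ⟨k, hk⟩
    rw [← zpow_natCast a d, ← zpow_mul] at hk
    have : (m : ℤ) ∣ d * k - i := by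
      rw [← h.zpow_a, zpow_sub, hk, mul_inv_cancel]
    have h2 := (Int.natCast_dvd_natCast.2 hd).trans this
    exact (dvd_sub_right (dvd_mul_right _ _)).1 h2
  · rintro ⟨k, rfl⟩
    exact ⟨k, by rw [zpow_mul, zpow_natCast]⟩

theorem exists_hasType (h : IsSplitMetacyclic m n r a b π) (H : Subgroup G) :
    ∃ d ∈ m.divisors, ∃ e ∈ n.divisors, HasType a b d e H := by
  obtain ⟨d, hd⟩ := H.exists_zpow_mem_iff_dvd a
  obtain ⟨e, he⟩ := (H.map π).exists_zpow_mem_iff_dvd (π b)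
  have hT : HasType a b d e H := by
    refine ⟨hd, fun j => ?_⟩
    have hb : (π b) ^ j = Multiplicative.ofAdd (j : ZMod n) := by simpa using h.map_form j 0
    rw [← he j, hb, Subgroup.mem_map]
    constructor
    · rintro ⟨i, hi⟩
      exact ⟨_, hi, h.map_form j i⟩
    · rintro ⟨x, hx, hxj⟩
      obtain ⟨k, i, rfl⟩ := h.exists_form x
      rw [← zpow_natCast, h.map_form] at hxj
      refine ⟨i, ?_⟩
      rwa [← h.zpow_b_eq (Multiplicative.ofAdd.injective hxj), zpow_natCast]
  refine ⟨d, ?_, e, ?_, hT⟩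
  · rw [Nat.mem_divisors]
    refine ⟨Int.natCast_dvd_natCast.1 ((hd m).1 ?_), h.m_pos.ne'⟩
    rw [(h.zpow_a m).2 dvd_rfl]
    exact H.one_mem
  · rw [Nat.mem_divisors]
    refine ⟨Int.natCast_dvd_natCast.1 ((hT.2 n).1 ⟨0, ?_⟩), h.n_pos.ne'⟩
    simp [h.b_pow]

theorem finite (h : IsSplitMetacyclic m n r a b π) : Finite G := by
  have ha : IsOfFinOrder a := isOfFinOrder_iff_pow_eq_one.2
    ⟨m, h.m_pos, by simpa using (h.zpow_a m).2 dvd_rfl⟩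
  have hb : IsOfFinOrder b := isOfFinOrder_iff_pow_eq_one.2 ⟨n, h.n_pos, h.b_pow⟩
  have fa : (Subgroup.zpowers a : Set G).Finite := ha.finite_zpowers
  have fb : (Subgroup.zpowers b : Set G).Finite := hb.finite_zpowers
  refine Set.finite_univ_iff.1 ((fb.mul fa).subset fun g _ => ?_)
  obtain ⟨j, i, rfl⟩ := h.exists_form g
  exact Set.mul_mem_mul ⟨j, by simp⟩ ⟨i, rfl⟩

/-- The subgroups of type `(d, e)` are the subgroups `⟨b ^ e * a ^ s, a ^ d⟩`. -/
theorem hasType_sup (h : IsSplitMetacyclic m n r a b π) {d e : ℕ} (hd : d ∣ m) (he : e ∣ n) (s : ℤ)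
    (hs : (d : ℤ) ∣ s * ∑ i ∈ Finset.range (n / e), ((r : ℤ) ^ e) ^ i) :
    HasType a b d e (Subgroup.zpowers (b ^ e * a ^ s) ⊔ Subgroup.zpowers (a ^ d)) := by
  have := h.normal_zpowers d
  have he0 : e ≠ 0 := by rintro rfl; exact h.n_pos.ne' (zero_dvd_iff.1 he)
  have hf : π (a ^ d) = 1 := by rw [map_pow, h.map_a, one_pow]
  have key : ∀ j i : ℤ, b ^ j * a ^ i ∈ Subgroup.zpowers (b ^ e * a ^ s) ⊔ Subgroup.zpowers (a ^ d) →
      ∃ k : ℤ, b ^ j * a ^ i * ((b ^ e * a ^ s) ^ k)⁻¹ ∈ Subgroup.zpowers (a ^ d) ∧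
        (n : ℤ) ∣ e * k - j := by
    intro j i hji
    obtain ⟨y, hy, z, hz, hyz⟩ := Subgroup.mem_sup_of_normal_right.1 hji
    obtain ⟨k, rfl⟩ := Subgroup.mem_zpowers_iff.1 hy
    refine ⟨k, ?_, ?_⟩
    · rw [← hyz]
      exact this.conj_mem _ hz _
    · obtain ⟨l, rfl⟩ := Subgroup.mem_zpowers_iff.1 hz
      have h1 := congrArg π hyz
      rw [h.map_form, map_mul, map_zpow π (a ^ d), hf, one_zpow, mul_one, map_zpow,
        ← zpow_natCast b e, h.map_form, ← ofAdd_zsmul] at h1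
      have h2 := Multiplicative.ofAdd.injective h1
      rw [← ZMod.intCast_eq_intCast_iff_dvd_sub, ← h2]
      simp [mul_comm]
  constructor
  · intro i
    rw [← h.mem_zpowers_iff hd]
    refine ⟨fun hi => ?_, fun hi => Subgroup.mem_sup_right hi⟩
    obtain ⟨k, hk, hnk⟩ := key 0 i (by simpa using hi)
    obtain ⟨c, rfl⟩ := he
    rw [sub_zero, Nat.cast_mul] at hnk
    obtain ⟨l, rfl⟩ := Int.dvd_of_mul_dvd_mul_left (by exact_mod_cast he0) hnk
    rw [Nat.mul_div_cancel_left _ (Nat.pos_of_ne_zero he0)] at hs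
    rw [zpow_mul, zpow_natCast, h.pow_b_mul, h.b_pow, one_mul, ← zpow_mul, zpow_zero, one_mul,
      ← zpow_neg, ← zpow_add, h.mem_zpowers_iff hd] at hk
    rw [h.mem_zpowers_iff hd]
    exact (dvd_add_left ((dvd_neg).2 (hs.mul_right l))).1 hk
  · intro j
    constructor
    · rintro ⟨i, hi⟩
      obtain ⟨k, -, hk⟩ := key j i hi
      have := (Int.natCast_dvd_natCast.2 he).trans hk
      exact (dvd_sub_right (dvd_mul_right _ _)).1 this
    · rintro ⟨k, rfl⟩
      have hmod : ((e * k : ℤ) : ZMod n) = ((e * (k % n).toNat : ℤ) : ZMod n) := by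
        have : ((k % n).toNat : ℤ) = k % n :=
          Int.toNat_of_nonneg (Int.emod_nonneg _ (by exact_mod_cast h.n_pos.ne'))
        rw [this]
        push_cast
        simp
      refine ⟨s * ∑ i ∈ Finset.range (k % n).toNat, ((r : ℤ) ^ e) ^ i, ?_⟩
      rw [h.zpow_b_eq hmod, ← Nat.cast_mul, zpow_natCast, ← h.pow_b_mul]
      exact Subgroup.mem_sup_left (Subgroup.pow_mem _ (Subgroup.mem_zpowers _) _)

theorem dvd_of_hasType (h : IsSplitMetacyclic m n r a b π) {d e : ℕ} (he : e ∣ n)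
    {H : Subgroup G} (hH : HasType a b d e H) {s : ℤ} (hs : b ^ e * a ^ s ∈ H) :
    (d : ℤ) ∣ s * ∑ i ∈ Finset.range (n / e), ((r : ℤ) ^ e) ^ i := by
  have := H.pow_mem hs (n / e)
  rwa [h.pow_b_mul, Nat.mul_div_cancel' he, h.b_pow, one_mul, hH.1] at this

theorem eq_sup_of_hasType (h : IsSplitMetacyclic m n r a b π) {d e : ℕ}
    {H : Subgroup G} (hH : HasType a b d e H) {s : ℤ} (hs : b ^ e * a ^ s ∈ H) :
    Subgroup.zpowers (b ^ e * a ^ s) ⊔ Subgroup.zpowers (a ^ d) = H := by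
  apply le_antisymm
  · rw [sup_le_iff, Subgroup.zpowers_le, Subgroup.zpowers_le]
    exact ⟨hs, by simpa using (hH.1 d).2 dvd_rfl⟩
  · intro g hg
    obtain ⟨j, i, rfl⟩ := h.exists_form g
    obtain ⟨k, rfl⟩ : e ∣ j := Int.natCast_dvd_natCast.1
      ((hH.2 j).1 ⟨i, by rwa [zpow_natCast]⟩)
    have hk := h.pow_b_mul e s k
    set u := s * ∑ i ∈ Finset.range k, ((r : ℤ) ^ e) ^ i
    have hg' : b ^ (e * k) * a ^ i = (b ^ e * a ^ s) ^ k * a ^ (i - u) := by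
      rw [hk, mul_assoc, ← zpow_add, add_sub_cancel]
    rw [hg'] at hg ⊢
    have h1 := (Subgroup.mul_mem_cancel_left H (H.pow_mem hs k)).1 hg
    obtain ⟨c, hc⟩ := (hH.1 _).1 h1
    refine Subgroup.mul_mem_sup (Subgroup.pow_mem _ (Subgroup.mem_zpowers _) _) ?_
    exact Subgroup.mem_zpowers_iff.2 ⟨c, by rw [hc, zpow_mul, zpow_natCast]⟩

theorem card_hasType (h : IsSplitMetacyclic m n r a b π) {d e : ℕ} (hd : d ∣ m) (he : e ∣ n) :
    Nat.card {H : Subgroup G // HasType a b d e H} =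
      Nat.gcd d (∑ i ∈ Finset.range (n / e), (r ^ e) ^ i) := by
  set t := ∑ i ∈ Finset.range (n / e), (r ^ e) ^ i with ht
  have htc : (∑ i ∈ Finset.range (n / e), ((r : ℤ) ^ e) ^ i) = (t : ℤ) := by
    rw [ht]; push_cast; rfl
  have hd0 : NeZero d := ⟨by rintro rfl; exact h.m_pos.ne' (zero_dvd_iff.1 hd)⟩
  have hker := IsAddCyclic.card_nsmulAddMonoidHom_ker (ZMod d) t
  rw [Nat.card_zmod] at hker
  rw [← hker]
  symm
  have hval : ∀ s : ZMod d, (((s.val : ℕ) : ℤ) : ZMod d) = s := fun s => by simp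
  have hdvd : ∀ s : ℤ, (d : ℤ) ∣ s * t ↔ (s : ZMod d) ∈ (nsmulAddMonoidHom t : ZMod d →+ _).ker := by
    intro s
    rw [AddMonoidHom.mem_ker, nsmulAddMonoidHom_apply, nsmul_eq_mul,
      ← ZMod.intCast_zmod_eq_zero_iff_dvd]
    push_cast
    rw [mul_comm]
  let f : (nsmulAddMonoidHom t : ZMod d →+ _).ker → {H : Subgroup G // HasType a b d e H} :=
    fun s => ⟨_, h.hasType_sup hd he (s.1.val : ℤ) (by
      rw [htc, hdvd, hval]; exact s.2)⟩
  refine Nat.card_congr (Equiv.ofBijective f ⟨?_, ?_⟩)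
  · intro s s' hss
    have h1 : b ^ e * a ^ (s.1.val : ℤ) ∈ (f s).1 :=
      Subgroup.mem_sup_left (Subgroup.mem_zpowers _)
    have h2 : b ^ e * a ^ (s'.1.val : ℤ) ∈ (f s).1 := by
      rw [hss]
      exact Subgroup.mem_sup_left (Subgroup.mem_zpowers _)
    have h3 := Subgroup.mul_mem _ (Subgroup.inv_mem _ h1) h2
    have h4 : (b ^ e * a ^ (s.1.val : ℤ))⁻¹ * (b ^ e * a ^ (s'.1.val : ℤ)) =
        a ^ ((s'.1.val : ℤ) - s.1.val) := by
      rw [sub_eq_neg_add, zpow_add]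
      group
    rw [h4, (f s).2.1, ← ZMod.intCast_eq_intCast_iff_dvd_sub, hval, hval] at h3
    exact Subtype.ext h3
  · rintro ⟨H, hH⟩
    obtain ⟨s, hs⟩ := (hH.2 e).2 dvd_rfl
    rw [zpow_natCast] at hs
    have hs' : b ^ e * a ^ (((s : ZMod d).val : ℕ) : ℤ) ∈ H := by
      have h1 : a ^ ((((s : ZMod d).val : ℕ) : ℤ) - s) ∈ H := by
        rw [hH.1, ← ZMod.intCast_eq_intCast_iff_dvd_sub, hval]
      have := H.mul_mem hs h1
      rwa [mul_assoc, ← zpow_add, add_sub_cancel] at this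
    refine ⟨⟨(s : ZMod d), ?_⟩, ?_⟩
    · rw [← hdvd, ← htc]
      exact h.dvd_of_hasType he hH hs
    · exact Subtype.ext (h.eq_sup_of_hasType hH hs')

end IsSplitMetacyclic

theorem Subgroup.card_dvd_of_mul_eq_univ {Q : Type*} [Group Q] (H K : Subgroup Q)
    (hHK : (H : Set Q) * (K : Set Q) = Set.univ) : Nat.card Q ∣ Nat.card H * Nat.card K := by
  have horb : MulAction.orbit H ((1 : Q) : Q ⧸ K) = Set.univ := by
    refine Set.eq_univ_of_forall fun x => ?_
    induction x using QuotientGroup.induction_on with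
    | H g =>
      obtain ⟨x, hx, y, hy, rfl⟩ : g ∈ (H : Set Q) * (K : Set Q) := by rw [hHK]; trivial
      refine ⟨⟨x, hx⟩, ?_⟩
      change ((x * 1 : Q) : Q ⧸ K) = _
      rw [mul_one, QuotientGroup.eq]
      simpa using hy
  have hidx : K.index ∣ Nat.card H := by
    have := MulAction.index_stabilizer H ((1 : Q) : Q ⧸ K)
    rw [horb, Set.ncard_univ] at this
    rw [Subgroup.index, ← this]
    exact Subgroup.index_dvd_card _
  rw [← K.card_mul_index, mul_comm]
  exact mul_dvd_mul_right hidx _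

namespace IsSplitMetacyclic

variable {G : Type*} [Group G] {m n r : ℕ} {a b : G} {π : G →* Multiplicative (ZMod n)}

theorem mul_eq_univ_of_coprime (h : IsSplitMetacyclic m n r a b π) {d e d' e' : ℕ}
    {H K : Subgroup G} (hH : HasType a b d e H) (hK : HasType a b d' e' K)
    (hd : Nat.gcd d d' = 1) (he : Nat.gcd e e' = 1) : (H : Set G) * (K : Set G) = Set.univ := by
  refine Set.eq_univ_of_forall fun g => ?_
  have split : ∀ {x y : ℕ}, Nat.gcd x y = 1 → ∀ j : ℤ, ∃ u v : ℤ, j = x * u + y * v := by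
    intro x y hxy j
    have := Nat.gcd_eq_gcd_ab x y
    rw [hxy, Nat.cast_one] at this
    exact ⟨x.gcdA y * j, x.gcdB y * j, by linear_combination j * this⟩
  obtain ⟨j, i, rfl⟩ := h.exists_form g
  obtain ⟨u, v, huv⟩ := split he j
  obtain ⟨s, hs⟩ := (hH.2 (e * u)).2 (dvd_mul_right _ _)
  obtain ⟨t, ht⟩ := (hK.2 (e' * v)).2 (dvd_mul_right _ _)
  obtain ⟨w, hw⟩ : ∃ w : ℤ, (b ^ (e * u : ℤ) * a ^ s)⁻¹ * (b ^ j * a ^ i) *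
      (b ^ (e' * v : ℤ) * a ^ t)⁻¹ = a ^ w := by
    apply h.exists_zpow_of_map_eq_one
    rw [map_mul, map_mul, map_inv, map_inv, ← zpow_natCast, h.map_form, h.map_form, h.map_form, huv,
      ← ofAdd_neg, ← ofAdd_neg, ← ofAdd_add, ← ofAdd_add, ofAdd_eq_one]
    push_cast
    ring
  obtain ⟨w₁, w₂, hw'⟩ := split hd w
  refine ⟨(b ^ (e * u : ℤ) * a ^ s) * a ^ (d * w₁ : ℤ),
    H.mul_mem hs ((hH.1 _).2 (dvd_mul_right _ _)),
    a ^ (d' * w₂ : ℤ) * (b ^ (e' * v : ℤ) * a ^ t),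
    K.mul_mem ((hK.1 _).2 (dvd_mul_right _ _)) ht, ?_⟩
  have e1 : a ^ w = a ^ (d * w₁ : ℤ) * a ^ (d' * w₂ : ℤ) := by rw [hw', zpow_add]
  rw [e1] at hw
  calc _ = (b ^ (e * u : ℤ) * a ^ s) * (a ^ (d * w₁ : ℤ) * a ^ (d' * w₂ : ℤ)) *
        (b ^ (e' * v : ℤ) * a ^ t) := by simp only [mul_assoc]
    _ = _ := by rw [← hw]; group

/-- Modulo `⟨a ^ c⟩`, a subgroup of type `(d, e)` with `c ∣ d` embeds into the cyclic group of
order `n`. -/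
theorem card_map_mk_dvd (h : IsSplitMetacyclic m n r a b π) {c d e : ℕ} (hcd : c ∣ d)
    {H : Subgroup G} (hH : HasType a b d e H) [(Subgroup.zpowers (a ^ c)).Normal] :
    Nat.card (H.map (QuotientGroup.mk' (Subgroup.zpowers (a ^ c)))) ∣ n := by
  have hker : Subgroup.zpowers (a ^ c) ≤ π.ker := by
    rw [Subgroup.zpowers_le, MonoidHom.mem_ker, map_pow, h.map_a, one_pow]
  let φ := (QuotientGroup.lift _ π hker).comp
    (H.map (QuotientGroup.mk' (Subgroup.zpowers (a ^ c)))).subtype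
  have hφ : Function.Injective φ := by
    rw [injective_iff_map_eq_one]
    rintro ⟨_, x, hx, rfl⟩ hx1
    replace hx1 : π x = 1 := hx1
    obtain ⟨i, rfl⟩ := h.exists_zpow_of_map_eq_one hx1
    obtain ⟨k, rfl⟩ := (Int.natCast_dvd_natCast.2 hcd).trans ((hH.1 i).1 hx)
    apply Subtype.ext
    refine (QuotientGroup.eq_one_iff _).2 (Subgroup.mem_zpowers_iff.2 ⟨k, ?_⟩)
    rw [zpow_mul, zpow_natCast]
  have := Subgroup.card_dvd_of_injective φ hφ
  rwa [Nat.card_congr (Multiplicative.toAdd (α := ZMod n)), Nat.card_zmod] at this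

theorem mul_eq_univ_iff (h : IsSplitMetacyclic m n r a b π) (hmn : Nat.gcd m n = 1)
    {d e d' e' : ℕ} (hd : d ∣ m) (he : e ∣ n)
    {H K : Subgroup G} (hH : HasType a b d e H) (hK : HasType a b d' e' K) :
    (H : Set G) * (K : Set G) = Set.univ ↔ Nat.gcd d d' = 1 ∧ Nat.gcd e e' = 1 := by
  refine ⟨fun hHK => ⟨?_, ?_⟩, fun hc => h.mul_eq_univ_of_coprime hH hK hc.1 hc.2⟩
  · set c := Nat.gcd d d'
    have := h.normal_zpowers c
    have hcm : c ∣ m := (Nat.gcd_dvd_left _ _).trans hd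
    let q := QuotientGroup.mk' (Subgroup.zpowers (a ^ c))
    have hq : ((H.map q : Subgroup _) : Set (G ⧸ Subgroup.zpowers (a ^ c))) *
        ((K.map q : Subgroup _) : Set (G ⧸ Subgroup.zpowers (a ^ c))) = Set.univ := by
      rw [Subgroup.coe_map, Subgroup.coe_map, ← Set.image_mul, hHK, Set.image_univ,
        (QuotientGroup.mk'_surjective _).range_eq]
    have h1 : Nat.card (G ⧸ Subgroup.zpowers (a ^ c)) ∣ n * n :=
      (Subgroup.card_dvd_of_mul_eq_univ _ _ hq).trans (mul_dvd_mul
        (h.card_map_mk_dvd (Nat.gcd_dvd_left _ _) hH) (h.card_map_mk_dvd (Nat.gcd_dvd_right _ _) hK))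
    have h2 : c ∣ orderOf (q a) := by
      have h3 : q (a ^ orderOf (q a)) = 1 := by rw [map_pow, pow_orderOf_eq_one]
      have h4 := (QuotientGroup.eq_one_iff _).1 h3
      exact Int.natCast_dvd_natCast.1 ((h.mem_zpowers_iff hcm _).1 (by rwa [zpow_natCast]))
    have h5 : c ∣ n * n := (h2.trans (orderOf_dvd_natCard _)).trans h1
    have h6 : Nat.Coprime c n := Nat.Coprime.coprime_dvd_left hcm hmn
    exact (h6.mul_right h6).eq_one_of_dvd h5
  · obtain ⟨x, hx, y, hy, hxy⟩ : b ∈ (H : Set G) * (K : Set G) := by rw [hHK]; trivial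
    obtain ⟨j, i, rfl⟩ := h.exists_form x
    obtain ⟨j', i', rfl⟩ := h.exists_form y
    have hj := (hH.2 j).1 ⟨i, by simpa using hx⟩
    have hj' := (hK.2 j').1 ⟨i', by simpa using hy⟩
    have h1 := congrArg π hxy
    simp only [← zpow_natCast] at h1
    rw [map_mul, h.map_form, h.map_form, h.map_b, ← ofAdd_add] at h1
    have h2 := Multiplicative.ofAdd.injective h1
    have h3 : ((j + j' : ℤ) : ZMod n) = (1 : ℤ) := by push_cast at h2 ⊢; exact h2
    have h4 := (Int.natCast_dvd_natCast.2 he).trans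
      ((ZMod.intCast_eq_intCast_iff_dvd_sub _ _ _).1 h3)
    have g1 : ((Nat.gcd e e' : ℕ) : ℤ) ∣ e := Int.natCast_dvd_natCast.2 (Nat.gcd_dvd_left _ _)
    have g2 : ((Nat.gcd e e' : ℕ) : ℤ) ∣ e' := Int.natCast_dvd_natCast.2 (Nat.gcd_dvd_right _ _)
    have g3 := (dvd_sub_left ((g1.trans hj).add (g2.trans hj'))).1 (g1.trans h4)
    exact Nat.dvd_one.1 (Int.natCast_dvd_natCast.1 (by simpa using g3))

theorem hasType_unique {d e d' e' : ℕ} {H : Subgroup G} (h : HasType a b d e H)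
    (h' : HasType a b d' e' H) : d = d' ∧ e = e' :=
  ⟨Nat.dvd_right_iff_eq.1 fun k => by
      rw [← Int.natCast_dvd_natCast, ← Int.natCast_dvd_natCast, ← h.1, ← h'.1],
    Nat.dvd_right_iff_eq.1 fun k => by
      rw [← Int.natCast_dvd_natCast, ← Int.natCast_dvd_natCast, ← h.2, ← h'.2]⟩

theorem card_factorizations (h : IsSplitMetacyclic m n r a b π) (hmn : Nat.gcd m n = 1) :
    Nat.card {p : Subgroup G × Subgroup G // (p.1 : Set G) * (p.2 : Set G) = Set.univ} =
      ∑ d ∈ m.divisors, ∑ d' ∈ m.divisors, ∑ e ∈ n.divisors, ∑ e' ∈ n.divisors,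
        if Nat.gcd d d' = 1 ∧ Nat.gcd e e' = 1 then
          Nat.gcd d (∑ i ∈ Finset.range (n / e), (r ^ e) ^ i) *
            Nat.gcd d' (∑ i ∈ Finset.range (n / e'), (r ^ e') ^ i)
        else 0 := by
  classical
  have := h.finite
  have := Fintype.ofFinite (Subgroup G)
  choose D hD E hE hT using h.exists_hasType
  rw [Nat.card_eq_fintype_card, Fintype.card_subtype,
    Finset.card_eq_sum_card_fiberwise (f := fun p => (D p.1, D p.2, E p.1, E p.2))
      (t := m.divisors ×ˢ m.divisors ×ˢ n.divisors ×ˢ n.divisors)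
      (fun p _ => by simp only [Finset.coe_product, Set.mem_prod]
                     exact ⟨hD _, hD _, hE _, hE _⟩)]
  simp only [Finset.sum_product]
  refine Finset.sum_congr rfl fun d hd => Finset.sum_congr rfl fun d' hd' =>
    Finset.sum_congr rfl fun e he => Finset.sum_congr rfl fun e' he' => ?_
  rw [← h.card_hasType (Nat.dvd_of_mem_divisors hd) (Nat.dvd_of_mem_divisors he),
    ← h.card_hasType (Nat.dvd_of_mem_divisors hd') (Nat.dvd_of_mem_divisors he'),
    Nat.card_eq_fintype_card, Nat.card_eq_fintype_card, Fintype.card_subtype, Fintype.card_subtype,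
    ← Finset.card_product]
  have hiff : ∀ (H : Subgroup G) (x y : ℕ), HasType a b x y H ↔ D H = x ∧ E H = y := fun H x y =>
    ⟨hasType_unique (hT H), by rintro ⟨rfl, rfl⟩; exact hT H⟩
  split_ifs with hc
  · congr 1
    ext ⟨H, K⟩
    simp only [Finset.mem_filter, Finset.mem_univ, true_and, Finset.mem_product, hiff, Prod.mk.injEq]
    rw [h.mul_eq_univ_iff hmn (Nat.dvd_of_mem_divisors (hD H)) (Nat.dvd_of_mem_divisors (hE H))
      (hT H) (hT K)]
    constructor
    · rintro ⟨-, rfl, rfl, rfl, rfl⟩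
      exact ⟨⟨rfl, rfl⟩, rfl, rfl⟩
    · rintro ⟨⟨rfl, rfl⟩, rfl, rfl⟩
      exact ⟨hc, rfl, rfl, rfl, rfl⟩
  · rw [Finset.card_eq_zero, Finset.filter_eq_empty_iff]
    rintro ⟨H, K⟩ hp heq
    simp only [Prod.mk.injEq] at heq
    obtain ⟨rfl, rfl, rfl, rfl⟩ := heq
    exact hc ((h.mul_eq_univ_iff hmn (Nat.dvd_of_mem_divisors (hD H))
      (Nat.dvd_of_mem_divisors (hE H)) (hT H) (hT K)).1 (Finset.mem_filter.1 hp).2)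

end IsSplitMetacyclic

theorem za_mul_zb (m n r : ℕ) : za m n r * zb m n r = zb m n r * za m n r ^ r := by
  have : PresentedGroup.mk (ZMrel m n r) ((FreeGroup.of 1)⁻¹ * FreeGroup.of 0 * FreeGroup.of 1 *
      (FreeGroup.of 0 ^ r)⁻¹) = 1 := PresentedGroup.one_of_mem (by simp [ZMrel])
  have h : (zb m n r)⁻¹ * za m n r * zb m n r * (za m n r ^ r)⁻¹ = 1 := by
    rw [map_mul, map_mul, map_mul, map_inv, map_inv, map_pow] at this
    exact this
  rw [mul_inv_eq_one, mul_assoc, inv_mul_eq_iff_eq_mul] at h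
  exact h

theorem za_pow (m n r : ℕ) : za m n r ^ m = 1 := by
  have : PresentedGroup.mk (ZMrel m n r) (FreeGroup.of 0 ^ m) = 1 :=
    PresentedGroup.one_of_mem (by simp [ZMrel])
  rwa [map_pow] at this

theorem zb_pow (m n r : ℕ) : zb m n r ^ n = 1 := by
  have : PresentedGroup.mk (ZMrel m n r) (FreeGroup.of 1 ^ n) = 1 :=
    PresentedGroup.one_of_mem (by simp [ZMrel])
  rwa [map_pow] at this

theorem ZM.exists_hom {m n r : ℕ} {G : Type*} [Group G] (x y : G) (hx : x ^ m = 1) (hy : y ^ n = 1)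
    (hxy : y⁻¹ * x * y = x ^ r) : ∃ φ : ZM m n r →* G, φ (za m n r) = x ∧ φ (zb m n r) = y := by
  have hrel : ∀ w ∈ ZMrel m n r, FreeGroup.lift ![x, y] w = 1 := by
    rintro w (rfl | rfl | rfl)
    · simpa using hx
    · simpa using hy
    · simpa using mul_inv_eq_one.2 hxy
  exact ⟨PresentedGroup.toGroup hrel, PresentedGroup.toGroup.of hrel, PresentedGroup.toGroup.of hrel⟩

theorem za_zpow_eq_one_iff {m n r : ℕ} (hn : 0 < n) (h3 : r ^ n ≡ 1 [MOD m]) (i : ℤ) :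
    za m n r ^ i = 1 ↔ (m : ℤ) ∣ i := by
  constructor
  · intro hi
    have hr : (r : ZMod m) ^ n = 1 := by
      have := (ZMod.natCast_eq_natCast_iff _ _ _).2 h3
      simpa using this
    have hn' : (r : ZMod m) * (r : ZMod m) ^ (n - 1) = 1 := by
      rw [← pow_succ', Nat.sub_add_cancel hn, hr]
    let u : (ZMod m)ˣ := Units.mkOfMulEqOne (r : ZMod m) _ hn'
    have hu : u ^ n = 1 := Units.ext (by simpa [u] using hr)
    have hmul : ∀ (k : ℕ) (z : ZMod m), ((Equiv.addRight (1 : ZMod m)) ^ k) z = z + k := by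
      intro k
      induction k with
      | zero => simp
      | succ k ih => intro z; rw [pow_succ', Equiv.Perm.mul_apply, ih]; simp [add_assoc]
    obtain ⟨φ, hφ, -⟩ := ZM.exists_hom (m := m) (n := n) (r := r)
      (Equiv.addRight (1 : ZMod m) : Equiv.Perm (ZMod m))
      (MulAction.toPermHom (ZMod m)ˣ (ZMod m) u⁻¹)
      (by ext z; rw [hmul]; simp) (by rw [← map_pow, inv_pow, hu, inv_one, map_one])
      (by
        ext z
        rw [hmul, ← map_inv, inv_inv]
        simp only [Equiv.Perm.mul_apply, MulAction.toPermHom_apply, MulAction.toPerm_apply,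
          Equiv.coe_addRight, smul_add, smul_inv_smul]
        simp [u, Units.smul_def])
    obtain ⟨k, rfl | rfl⟩ := i.eq_nat_or_neg
    all_goals
      have hk : za m n r ^ k = 1 := by simpa using hi
      have h2 := hmul k 0
      rw [← hφ, ← map_pow, hk, map_one] at h2
      have h4 : (k : ZMod m) = 0 := by simpa using h2.symm
      have h5 := Int.natCast_dvd_natCast.2 ((ZMod.natCast_eq_zero_iff _ _).1 h4)
      simpa using h5
  · rintro ⟨k, rfl⟩
    rw [zpow_mul, zpow_natCast, za_pow, one_zpow]

theorem ZM.exists_form {m n r : ℕ} (hn : 0 < n) (g : ZM m n r) :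
    ∃ (j : ℕ) (i : ℤ), g = zb m n r ^ j * za m n r ^ i := by
  have hab : ∀ (j : ℕ) (i : ℤ), za m n r ^ i * zb m n r ^ j =
      zb m n r ^ j * za m n r ^ (i * r ^ j) := zpow_mul_pow_of_mul_eq (za_mul_zb m n r)
  have hg : g ∈ Subgroup.closure (Set.range (PresentedGroup.of (rels := ZMrel m n r))) := by
    rw [PresentedGroup.closure_range_of]
    trivial
  have cases01 : ∀ x ∈ Set.range (PresentedGroup.of (rels := ZMrel m n r)),
      x = za m n r ∨ x = zb m n r := by
    rintro _ ⟨k, rfl⟩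
    fin_cases k
    · exact Or.inl rfl
    · exact Or.inr rfl
  induction hg using Subgroup.closure_induction_left with
  | one => exact ⟨0, 0, by simp⟩
  | mul_left x hx y _ ih =>
    obtain ⟨j, i, rfl⟩ := ih
    obtain rfl | rfl := cases01 x hx
    · refine ⟨j, r ^ j + i, ?_⟩
      have := hab j 1
      rw [zpow_one, one_mul] at this
      rw [← mul_assoc, this, mul_assoc, zpow_add]
    · exact ⟨j + 1, i, by rw [pow_succ', mul_assoc]⟩
  | inv_mul_cancel x hx y _ ih =>
    obtain ⟨j, i, rfl⟩ := ih
    obtain rfl | rfl := cases01 x hx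
    · refine ⟨j, -r ^ j + i, ?_⟩
      have := hab j (-1)
      rw [zpow_neg_one, neg_one_mul] at this
      rw [← mul_assoc, this, mul_assoc, zpow_add]
    · refine ⟨n - 1 + j, i, ?_⟩
      have : (zb m n r)⁻¹ = zb m n r ^ (n - 1) := by
        rw [inv_eq_iff_mul_eq_one, ← pow_succ', Nat.sub_add_cancel hn, zb_pow]
      rw [this, pow_add, mul_assoc]

theorem ZM.isSplitMetacyclic {m n r : ℕ} (hm : 0 < m) (hn : 0 < n) (h3 : r ^ n ≡ 1 [MOD m]) :
    ∃ π : ZM m n r →* Multiplicative (ZMod n),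
      IsSplitMetacyclic m n r (za m n r) (zb m n r) π := by
  obtain ⟨π, ha, hb⟩ := ZM.exists_hom (m := m) (n := n) (r := r)
    (1 : Multiplicative (ZMod n)) (Multiplicative.ofAdd 1) (one_pow _)
    (by rw [← ofAdd_nsmul]; simp) (by simp)
  exact ⟨π, hm, hn, zb_pow m n r, za_mul_zb m n r, za_zpow_eq_one_iff hn h3, ha, hb,
    ZM.exists_form hn⟩

theorem gcd_geom_sum_eq {m n r d e : ℕ} (hn : 0 < n) (hr : 0 < r) (h2 : Nat.gcd m (r - 1) = 1)
    (hd : d ∣ m) (he : e ∣ n) :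
    Nat.gcd d (∑ i ∈ Finset.range (n / e), (r ^ e) ^ i) =
      Nat.gcd d ((r ^ n - 1) / (r ^ e - 1)) := by
  obtain rfl | hr1 : r = 1 ∨ 2 ≤ r := by omega
  · obtain rfl : m = 1 := by simpa using h2
    obtain rfl := Nat.dvd_one.1 hd
    simp
  · have he0 : e ≠ 0 := by rintro rfl; exact hn.ne' (zero_dvd_iff.1 he)
    have : 2 ≤ r ^ e := hr1.trans (Nat.le_self_pow he0 r)
    rw [Nat.geomSum_eq this, ← pow_mul, Nat.mul_div_cancel' he]

/-- The factorization number of `ZM(m,n,r)`:  the number of ordered pairs of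
subgroups `(H,K)` with `HK = ZM(m,n,r)` equals the stated sum of gcd's. -/
theorem F2_ZM (m n r : ℕ)
    (hm : 0 < m) (hn : 0 < n) (hr : 0 < r)
    (h1 : Nat.gcd m n = 1) (h2 : Nat.gcd m (r - 1) = 1) (h3 : r ^ n ≡ 1 [MOD m]) :
    Nat.card {p : Subgroup (ZM m n r) × Subgroup (ZM m n r) //
        (p.1 : Set (ZM m n r)) * (p.2 : Set (ZM m n r)) = Set.univ} =
      ∑ m₂ ∈ m.divisors, ∑ m₃ ∈ m.divisors, ∑ n₂ ∈ n.divisors, ∑ n₃ ∈ n.divisors,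
        if Nat.gcd m₂ m₃ = 1 ∧ Nat.gcd n₂ n₃ = 1 then
          Nat.gcd m₂ ((r ^ n - 1) / (r ^ n₂ - 1)) *
            Nat.gcd m₃ ((r ^ n - 1) / (r ^ n₃ - 1))
        else 0 := by
  obtain ⟨π, h⟩ := ZM.isSplitMetacyclic hm hn h3
  rw [h.card_factorizations h1]
  refine Finset.sum_congr rfl fun d hd => Finset.sum_congr rfl fun d' hd' =>
    Finset.sum_congr rfl fun e he => Finset.sum_congr rfl fun e' he' => ?_
  rw [gcd_geom_sum_eq hn hr h2 (Nat.dvd_of_mem_divisors hd) (Nat.dvd_of_mem_divisors he),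
    gcd_geom_sum_eq hn hr h2 (Nat.dvd_of_mem_divisors hd') (Nat.dvd_of_mem_divisors he')]
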